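/- Let 2 ≤ k ≤ d and m ≥ 1. For every λ > 0, every global minimizer (θ̂_s, φ̂) of the regularized source objective L_source^λ(θ_s, φ) = L_{D_s^{(k)}}(θ_s, φ) + λ(‖θ_s‖^2 + ‖φ‖_F^2) is of one of the following two forms: (i) θ̂_s = 0 and φ̂ = 0; or (ii) there exist an index i_0 ∈ {1,…,m} and an index j ∈ {1,…,k} such that the i_0-th entry of θ̂_s is strictly positive, the i_0-th column of φ̂ equals ±√2·(θ̂_s)_{i_0}·e_j, and all other entries of θ̂_s and all other columns of φ̂ are zero. Moreover, if 0 < λ < 0.1 then every global minimizer is of form (ii). -/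

import Mathlib

open MeasureTheory Finset

noncomputable section

/-- Uniform measure on `{-1, 0, 1} ⊆ ℝ`. -/
def unif3 : Measure ℝ :=
  (PMF.uniformOfFinset ({-1, 0, 1} : Finset ℝ) (by norm_num)).toMeasure

/-- Uniform measure on `{-1, 1} ⊆ ℝ`. -/
def unif2 : Measure ℝ :=
  (PMF.uniformOfFinset ({-1, 1} : Finset ℝ) (by norm_num)).toMeasure

/-- Distribution of `x` conditioned on `y = 0` under the source distribution `D_s^(k)`. -/
def srcBranch0 (d k : ℕ) : Measure (Fin d → ℝ) :=
  Measure.pi (fun i => if (i : ℕ) < k then Measure.dirac (0 : ℝ) else unif3)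

/-- Distribution of `x` conditioned on `y = 1` under the source distribution `D_s^(k)`. -/
def srcBranch1 (d k : ℕ) : Measure (Fin d → ℝ) :=
  Measure.pi (fun i => if (i : ℕ) < k then unif2 else unif3)

/-- The source distribution `D_s^(k)` on `ℝ^d × ℝ`. -/
def sourceMeasure (d k : ℕ) : Measure ((Fin d → ℝ) × ℝ) :=
  (1/3 : ENNReal) • (srcBranch0 d k).map (fun x => (x, (0 : ℝ)))
    + (2/3 : ENNReal) • (srcBranch1 d k).map (fun x => (x, (1 : ℝ)))

/-- The target distribution `D_t = D_s^(1)`. -/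
def targetMeasure (d : ℕ) : Measure ((Fin d → ℝ) × ℝ) := sourceMeasure d 1

/-- The two-layer quadratic network `f_{θ,φ}(x) = ∑ i, θ i (w_i ⬝ x)^2`,
where `w_i` is the `i`-th column of `φ`. -/
def qnet {d m : ℕ} (θ : Fin m → ℝ) (φ : Matrix (Fin d) (Fin m) ℝ) (x : Fin d → ℝ) : ℝ :=
  ∑ i, θ i * (∑ j, φ j i * x j) ^ 2

/-- Population squared loss on the distribution `D`. -/
def popLoss {d m : ℕ} (D : Measure ((Fin d → ℝ) × ℝ)) (θ : Fin m → ℝ)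
    (φ : Matrix (Fin d) (Fin m) ℝ) : ℝ :=
  ∫ p, (qnet θ φ p.1 - p.2) ^ 2 ∂D

/-- Empirical squared loss on the dataset `S`. -/
def empLoss {d m n : ℕ} (S : Fin n → (Fin d → ℝ) × ℝ) (θ : Fin m → ℝ)
    (φ : Matrix (Fin d) (Fin m) ℝ) : ℝ :=
  (1 / (n : ℝ)) * ∑ i, (qnet θ φ (S i).1 - (S i).2) ^ 2

/-- Squared Frobenius norm of the feature extractor. -/
def frobSq {d m : ℕ} (φ : Matrix (Fin d) (Fin m) ℝ) : ℝ := ∑ j, ∑ i, (φ j i) ^ 2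

/-- Squared Euclidean norm of a head. -/
def normSq {m : ℕ} (θ : Fin m → ℝ) : ℝ := ∑ i, (θ i) ^ 2

/-- The regularized joint training objective `L_joint^λ`. -/
def jointObj {d m n : ℕ} (k : ℕ) (α lam : ℝ) (S : Fin n → (Fin d → ℝ) × ℝ)
    (θs θt : Fin m → ℝ) (φ : Matrix (Fin d) (Fin m) ℝ) : ℝ :=
  (1 - α) * popLoss (sourceMeasure d k) θs φ + α * empLoss S θt φ
    + lam * (normSq θs + normSq θt + frobSq φ)

end

/-- Form (ii) of Lemma 4: one coordinate `i0` of the head is strictly positive, the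
corresponding column of `φ` is `±√2 (θ_s)_{i0} e_j` for some `j ∈ {1, …, k}` (0-based:
`(j : ℕ) < k`), and every other head entry and column vanishes. -/
def sourceMinimizerFormII {d m : ℕ} (k : ℕ) (θs : Fin m → ℝ)
    (φ : Matrix (Fin d) (Fin m) ℝ) : Prop :=
  ∃ (i0 : Fin m) (j : Fin d), (j : ℕ) < k ∧ 0 < θs i0 ∧
    ((∀ l : Fin d, φ l i0 = (Real.sqrt 2 * θs i0) * (if l = j then 1 else 0)) ∨
      (∀ l : Fin d, φ l i0 = -(Real.sqrt 2 * θs i0) * (if l = j then 1 else 0))) ∧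
    ∀ i : Fin m, i ≠ i0 → θs i = 0 ∧ ∀ l : Fin d, φ l i = 0


instance : IsProbabilityMeasure unif2 := by unfold unif2; infer_instance
instance : IsProbabilityMeasure unif3 := by unfold unif3; infer_instance

lemma unif2_ae : ∀ᵐ x ∂unif2, x ^ 2 = 1 := by
  unfold unif2
  rw [ae_iff, PMF.toMeasure_apply_eq_zero_iff _ (by measurability)]
  rw [PMF.support_uniformOfFinset]
  rw [Set.disjoint_left]
  intro a ha h
  simp at ha h
  rcases ha with rfl | rfl <;> simp at h

lemma unif3_ae : ∀ᵐ x ∂unif3, x ∈ Set.Icc (-1:ℝ) 1 := by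
  unfold unif3
  rw [ae_iff, PMF.toMeasure_apply_eq_zero_iff _ (by measurability)]
  rw [PMF.support_uniformOfFinset]
  rw [Set.disjoint_left]
  intro a ha h
  simp only [coe_insert, coe_singleton, Set.mem_insert_iff, Set.mem_singleton_iff] at ha
  apply h
  rcases ha with rfl | rfl | rfl <;> norm_num

lemma unif2_mean : ∫ x, x ∂unif2 = 0 := by
  unfold unif2
  rw [PMF.integral_eq_tsum _ _ ?_, tsum_eq_sum (s := ({-1, 1} : Finset ℝ))]
  · rw [Finset.sum_pair (by norm_num)]
    simp [PMF.uniformOfFinset_apply]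
  · intro b hb
    rw [PMF.uniformOfFinset_apply_of_notMem _ hb]; simp
  · have := unif2_ae
    unfold unif2 at this
    refine Integrable.of_bound (C := 1) (by fun_prop) ?_
    filter_upwards [this] with x hx
    rw [Real.norm_eq_abs, ← sq_le_one_iff_abs_le_one]; exact hx.le

lemma unif3_mean : ∫ x, x ∂unif3 = 0 := by
  unfold unif3
  rw [PMF.integral_eq_tsum _ _ ?_, tsum_eq_sum (s := ({-1, 0, 1} : Finset ℝ))]
  · rw [Finset.sum_insert (by norm_num), Finset.sum_pair (by norm_num)]
    simp [PMF.uniformOfFinset_apply]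
  · intro b hb
    rw [PMF.uniformOfFinset_apply_of_notMem _ hb]; simp
  · have := unif3_ae
    unfold unif3 at this
    refine Integrable.of_bound (C := 1) (by fun_prop) ?_
    filter_upwards [this] with x hx
    rw [Real.norm_eq_abs, abs_le]; exact hx

lemma unif2_pos (a : ℝ) (ha : a = -1 ∨ a = 1) : unif2 {a} ≠ 0 := by
  unfold unif2
  rw [PMF.toMeasure_apply_singleton _ _ (by measurability)]
  rw [← PMF.mem_support_iff, PMF.mem_support_uniformOfFinset_iff]
  simpa using ha

lemma unif3_pos (a : ℝ) (ha : a = -1 ∨ a = 0 ∨ a = 1) : unif3 {a} ≠ 0 := by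
  unfold unif3
  rw [PMF.toMeasure_apply_singleton _ _ (by measurability)]
  rw [← PMF.mem_support_iff, PMF.mem_support_uniformOfFinset_iff]
  simpa using ha

/-- Branch marginals. -/
noncomputable def nu0 (d k : ℕ) (i : Fin d) : Measure ℝ :=
  if (i : ℕ) < k then Measure.dirac (0 : ℝ) else unif3

/-- Branch marginals. -/
noncomputable def nu1 (d k : ℕ) (i : Fin d) : Measure ℝ :=
  if (i : ℕ) < k then unif2 else unif3

instance (d k : ℕ) (i : Fin d) : IsProbabilityMeasure (nu0 d k i) := by
  unfold nu0; split_ifs <;> infer_instance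
instance (d k : ℕ) (i : Fin d) : IsProbabilityMeasure (nu1 d k i) := by
  unfold nu1; split_ifs <;> infer_instance

lemma src0_eq (d k : ℕ) : srcBranch0 d k = Measure.pi (nu0 d k) := rfl
lemma src1_eq (d k : ℕ) : srcBranch1 d k = Measure.pi (nu1 d k) := rfl

instance (d k : ℕ) : IsProbabilityMeasure (srcBranch0 d k) := by
  rw [src0_eq]; infer_instance
instance (d k : ℕ) : IsProbabilityMeasure (srcBranch1 d k) := by
  rw [src1_eq]; infer_instance

lemma nu0_ae (d k : ℕ) (i : Fin d) : ∀ᵐ x ∂(nu0 d k i), x ∈ Set.Icc (-1:ℝ) 1 := by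
  unfold nu0; split_ifs
  · rw [ae_dirac_eq]; simp
  · exact unif3_ae

lemma nu1_ae (d k : ℕ) (i : Fin d) : ∀ᵐ x ∂(nu1 d k i), x ∈ Set.Icc (-1:ℝ) 1 := by
  unfold nu1; split_ifs
  · filter_upwards [unif2_ae] with x hx
    constructor <;> nlinarith
  · exact unif3_ae

lemma nu1_mean (d k : ℕ) (i : Fin d) : ∫ x, x ∂(nu1 d k i) = 0 := by
  unfold nu1; split_ifs
  · exact unif2_mean
  · exact unif3_mean

lemma integrable_pi_of_cont {d : ℕ} (ν : Fin d → Measure ℝ) [∀ i, IsProbabilityMeasure (ν i)]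
    (h : ∀ i, ∀ᵐ x ∂(ν i), x ∈ Set.Icc (-1:ℝ) 1) (f : (Fin d → ℝ) → ℝ) (hf : Continuous f) :
    Integrable f (Measure.pi ν) := by
  have hae : ∀ᵐ x ∂(Measure.pi ν), x ∈ Set.Icc (fun _ => -1 : Fin d → ℝ) (fun _ => 1) := by
    have : ∀ i, ∀ᵐ x ∂(Measure.pi ν), x i ∈ Set.Icc (-1:ℝ) 1 := fun i =>
      (Measure.quasiMeasurePreserving_eval ν i).ae (h i)
    filter_upwards [ae_all_iff.2 this] with x hx
    exact ⟨fun i => (hx i).1, fun i => (hx i).2⟩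
  have := hf.continuousOn.integrableOn_compact (μ := Measure.pi ν)
    (isCompact_Icc (a := (fun _ => -1 : Fin d → ℝ)) (b := fun _ => 1))
  rwa [IntegrableOn, Measure.restrict_eq_self_of_ae_mem hae] at this

lemma int0 {d k : ℕ} (f : (Fin d → ℝ) → ℝ) (hf : Continuous f) :
    Integrable f (srcBranch0 d k) := integrable_pi_of_cont _ (nu0_ae d k) f hf
lemma int1 {d k : ℕ} (f : (Fin d → ℝ) → ℝ) (hf : Continuous f) :
    Integrable f (srcBranch1 d k) := integrable_pi_of_cont _ (nu1_ae d k) f hf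

lemma qnet_cont {d m : ℕ} (θ : Fin m → ℝ) (φ : Matrix (Fin d) (Fin m) ℝ) :
    Continuous (qnet θ φ) := by unfold qnet; fun_prop

lemma popLoss_eq {d m : ℕ} (k : ℕ) (θ : Fin m → ℝ) (φ : Matrix (Fin d) (Fin m) ℝ) :
    popLoss (sourceMeasure d k) θ φ = 1/3 * ∫ x, (qnet θ φ x)^2 ∂(srcBranch0 d k)
      + 2/3 * ∫ x, (qnet θ φ x - 1)^2 ∂(srcBranch1 d k) := by
  have hq := qnet_cont θ φ
  have hg : Continuous (fun p : (Fin d → ℝ) × ℝ => (qnet θ φ p.1 - p.2) ^ 2) := by fun_prop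
  have m0 : Measurable (fun x : Fin d → ℝ => (x, (0:ℝ))) := by fun_prop
  have m1 : Measurable (fun x : Fin d → ℝ => (x, (1:ℝ))) := by fun_prop
  unfold popLoss sourceMeasure
  rw [integral_add_measure, integral_smul_measure, integral_smul_measure,
    integral_map m0.aemeasurable hg.aestronglyMeasurable,
    integral_map m1.aemeasurable hg.aestronglyMeasurable]
  · simp
  · apply Integrable.smul_measure _ (by simp)
    rw [integrable_map_measure hg.aestronglyMeasurable m0.aemeasurable]
    exact int0 _ (by simp only [Function.comp_def]; fun_prop)
  · apply Integrable.smul_measure _ (ENNReal.div_ne_top (by simp) (by simp))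
    rw [integrable_map_measure hg.aestronglyMeasurable m1.aemeasurable]
    exact int1 _ (by simp only [Function.comp_def]; fun_prop)

/-- Mean of the network on the positive branch. -/
noncomputable def qmean {d m : ℕ} (k : ℕ) (θ : Fin m → ℝ) (φ : Matrix (Fin d) (Fin m) ℝ) : ℝ :=
  ∫ x, qnet θ φ x ∂(srcBranch1 d k)

lemma popLoss_decomp {d m : ℕ} (k : ℕ) (θ : Fin m → ℝ) (φ : Matrix (Fin d) (Fin m) ℝ) :
    popLoss (sourceMeasure d k) θ φ = 1/3 * ∫ x, (qnet θ φ x)^2 ∂(srcBranch0 d k)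
      + 2/3 * ((qmean k θ φ - 1)^2 + ∫ x, (qnet θ φ x - qmean k θ φ)^2 ∂(srcBranch1 d k)) := by
  rw [popLoss_eq]
  congr 2
  have hq := qnet_cont θ φ
  have h1 : ∀ x, (qnet θ φ x - 1)^2 = (qnet θ φ x - qmean k θ φ)^2 +
     ((2 * (qmean k θ φ - 1)) * qnet θ φ x + (1 - (qmean k θ φ)^2)) := by intro x; ring
  simp_rw [h1]
  rw [integral_add (int1 _ (by fun_prop)) (int1 _ (by fun_prop)),
    integral_add (int1 _ (by fun_prop)) (int1 _ (by fun_prop)), integral_const_mul]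
  change _ + (_ * qmean k θ φ + _) = _
  simp
  ring

lemma neuron_mean_le {d : ℕ} (k : ℕ) (w : Fin d → ℝ) :
    ∫ x, (∑ j, w j * x j) ^ 2 ∂(srcBranch1 d k) ≤ ∑ j, w j ^ 2 := by
  rw [src1_eq]
  have hL : ∀ i, MemLp (fun x : ℝ => w i * x) 2 (nu1 d k i) := fun i => by
    refine MemLp.of_bound (by fun_prop) (|w i|) ?_
    filter_upwards [nu1_ae d k i] with x hx
    rw [Real.norm_eq_abs, abs_mul]
    exact mul_le_of_le_one_right (abs_nonneg _) (abs_le.2 hx)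
  have hv := ProbabilityTheory.variance_sum_pi (μ := nu1 d k) hL
  have hm : ∫ x, (∑ j, w j * x j) ∂(Measure.pi (nu1 d k)) = 0 := by
    rw [integral_finsetSum _ (fun i _ => integrable_pi_of_cont _ (nu1_ae d k) _ (by fun_prop))]
    apply Finset.sum_eq_zero
    intro i _
    have h := integral_comp_eval (μ := nu1 d k) (i := i) (f := fun x : ℝ => x)
      (Continuous.aestronglyMeasurable (by fun_prop))
    rw [integral_const_mul, h, nu1_mean, mul_zero]
  have he : (∑ i, fun ω : Fin d → ℝ => w i * ω i) = fun ω => ∑ i, w i * ω i := by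
    ext; simp
  rw [he, ProbabilityTheory.variance_of_integral_eq_zero
    (Continuous.aemeasurable (by fun_prop)) hm] at hv
  rw [hv]
  apply Finset.sum_le_sum
  intro i _
  refine (ProbabilityTheory.variance_le_expectation_sq (hL i).1).trans ?_
  have : ∫ x, ((fun x : ℝ => w i * x) ^ 2) x ∂(nu1 d k i) ≤ ∫ x, w i ^ 2 ∂(nu1 d k i) := by
    apply integral_mono_ae (hL i).integrable_sq (integrable_const _)
    filter_upwards [nu1_ae d k i] with x hx
    simp only [mul_pow]
    apply mul_le_of_le_one_right (sq_nonneg _)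
    nlinarith [hx.1, hx.2]
  simpa using this

lemma qmean_eq {d m : ℕ} (k : ℕ) (θ : Fin m → ℝ) (φ : Matrix (Fin d) (Fin m) ℝ) :
    qmean k θ φ = ∑ i, θ i * ∫ x, (∑ j, φ j i * x j) ^ 2 ∂(srcBranch1 d k) := by
  unfold qmean qnet
  rw [integral_finsetSum _ (fun i _ => int1 _ (by fun_prop))]
  simp_rw [integral_const_mul]

lemma atom_zero {d : ℕ} (ν : Fin d → Measure ℝ) [∀ i, IsProbabilityMeasure (ν i)]
    (f : (Fin d → ℝ) → ℝ) (hint : Integrable (fun x => f x ^ 2) (Measure.pi ν))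
    (h0 : ∫ x, f x ^ 2 ∂(Measure.pi ν) = 0)
    (x : Fin d → ℝ) (hx : ∀ i, ν i {x i} ≠ 0) : f x = 0 := by
  rw [integral_eq_zero_iff_of_nonneg (fun x => sq_nonneg _) hint] at h0
  by_contra hne
  have h1 : (Measure.pi ν) {x} = 0 := by
    refine measure_mono_null ?_ h0
    intro y hy
    rw [Set.mem_singleton_iff] at hy
    subst hy
    simpa using hne
  rw [Measure.pi_singleton, Finset.prod_eq_zero_iff] at h1
  obtain ⟨i, _, hi⟩ := h1
  exact hx i hi

/-- Competitor feature matrix. -/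
noncomputable def compPhi {d m : ℕ} (i0 : Fin m) (j0 : Fin d) (s : ℝ) : Matrix (Fin d) (Fin m) ℝ :=
  Matrix.of fun j i => if i = i0 then (if j = j0 then Real.sqrt 2 * s else 0) else 0

lemma comp_loss {d m : ℕ} (k : ℕ) (i0 : Fin m) (j0 : Fin d) (hj : (j0 : ℕ) < k) (s : ℝ) :
    popLoss (sourceMeasure d k) (fun i => if i = i0 then s else 0)
      (compPhi i0 j0 s)
      = 2/3 * (2 * s^3 - 1)^2 := by
  have hq : ∀ x : Fin d → ℝ, qnet (fun i => if i = i0 then s else 0)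
      (compPhi i0 j0 s) x
      = 2 * s^3 * (x j0)^2 := by
    intro x
    have := Real.sq_sqrt (show (0:ℝ) ≤ 2 by norm_num)
    simp only [qnet, compPhi, Matrix.of_apply, ite_mul, zero_mul, Finset.sum_ite_eq', Finset.mem_univ, if_true]
    simp only [mul_pow, this]
    ring
  rw [popLoss_eq]
  simp_rw [hq]
  have e0 : ∫ x, (2 * s^3 * (x j0)^2)^2 ∂(srcBranch0 d k) = ∫ x, (0:ℝ) ∂(srcBranch0 d k) := by
    apply integral_congr_ae
    have h : ∀ᵐ x ∂(nu0 d k j0), x = 0 := by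
      unfold nu0; rw [if_pos hj, ae_dirac_eq]; simp
    filter_upwards [(Measure.quasiMeasurePreserving_eval (nu0 d k) j0).ae h] with x hx
    simp only [Function.eval] at hx
    simp [hx]
  have e1 : ∫ x, (2 * s^3 * (x j0)^2 - 1)^2 ∂(srcBranch1 d k)
      = ∫ x, (2 * s^3 - 1)^2 ∂(srcBranch1 d k) := by
    apply integral_congr_ae
    have h : ∀ᵐ x ∂(nu1 d k j0), x ^ 2 = 1 := by
      unfold nu1; rw [if_pos hj]; exact unif2_ae
    filter_upwards [(Measure.quasiMeasurePreserving_eval (nu1 d k) j0).ae h] with x hx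
    simp only [Function.eval] at hx
    simp [hx]
  rw [e0, e1]
  simp

lemma comp_reg {d m : ℕ} (i0 : Fin m) (j0 : Fin d) (s : ℝ) :
    normSq (fun i => if i = i0 then s else 0) + frobSq
      (compPhi i0 j0 s)
      = 3 * s^2 := by
  have := Real.sq_sqrt (show (0:ℝ) ≤ 2 by norm_num)
  simp [normSq, frobSq, compPhi, ite_pow, mul_pow, this]
  ring

/-- Single-neuron rigidity. -/
lemma rigid {d : ℕ} (k : ℕ) (w : Fin d → ℝ) (c : ℝ) (hc : 0 < c)
    (h0 : ∀ x : Fin d → ℝ, (∀ i, nu0 d k i {x i} ≠ 0) → (∑ j, w j * x j)^2 = 0)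
    (h1 : ∀ x : Fin d → ℝ, (∀ i, nu1 d k i {x i} ≠ 0) → (∑ j, w j * x j)^2 = c) :
    ∃ j : Fin d, (j : ℕ) < k ∧ ∀ l, l ≠ j → w l = 0 := by
  have hz : ∀ j : Fin d, ¬ (j : ℕ) < k → w j = 0 := by
    intro j hj
    have := h0 (Pi.single j 1) (by
      intro i
      unfold nu0
      by_cases hij : i = j
      · subst hij; rw [if_neg hj]; exact unif3_pos _ (by simp)
      · rw [Pi.single_eq_of_ne hij]
        split_ifs
        · simp
        · exact unif3_pos _ (by simp))
    simpa [Pi.single_apply] using this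
  have hx1 : ∀ x : Fin d → ℝ, (∀ i, x i = -1 ∨ x i = 1) → (∑ j, w j * x j)^2 = c := by
    intro x hx
    apply h1
    intro i
    unfold nu1
    split_ifs
    · exact unif2_pos _ (hx i)
    · exact unif3_pos _ (by rcases hx i with h | h <;> simp [h])
  have hone := hx1 (fun _ => 1) (by simp)
  -- some nonzero weight
  have hex : ∃ j, w j ≠ 0 := by
    by_contra hcon
    push Not at hcon
    simp [hcon] at hone
    linarith
  obtain ⟨j, hj⟩ := hex
  refine ⟨j, by by_contra h; exact hj (hz j h), ?_⟩
  have key : ∀ x : Fin d → ℝ, (∀ i, x i = -1 ∨ x i = 1) → x j = 1 → ∑ i, w i * x i = w j := by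
    intro x hx hxj
    have a := hx1 x hx
    have b := hx1 (Function.update x j (-1)) (by
      intro i
      by_cases hij : i = j
      · subst hij; simp
      · simp [hij, hx i])
    have e : ∑ i, w i * (Function.update x j (-1)) i = ∑ i, w i * x i - 2 * w j := by
      rw [← Finset.add_sum_erase _ _ (Finset.mem_univ j),
        ← Finset.add_sum_erase _ (fun i => w i * x i) (Finset.mem_univ j)]
      rw [Finset.sum_congr rfl (g := fun i => w i * x i)]
      · simp [hxj]; ring
      · intro i hi
        rw [Function.update_of_ne (Finset.ne_of_mem_erase hi)]
    rw [e, ← a] at b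
    have : w j * (∑ i, w i * x i - w j) = 0 := by nlinarith
    rcases mul_eq_zero.1 this with h | h
    · exact absurd h hj
    · linarith
  intro l hl
  have k1 := key (fun _ => 1) (by simp) rfl
  have k2 := key (Function.update (fun _ => 1) l (-1)) (by
      intro i
      by_cases hij : i = l
      · subst hij; simp
      · simp [hij]) (by rw [Function.update_of_ne hl.symm])
  have e : ∑ i, w i * (Function.update (fun _ => (1:ℝ)) l (-1)) i
      = ∑ i, w i * (fun _ => (1:ℝ)) i - 2 * w l := by
    rw [← Finset.add_sum_erase _ _ (Finset.mem_univ l),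
      ← Finset.add_sum_erase _ (fun i => w i * (fun _ => (1:ℝ)) i) (Finset.mem_univ l)]
    rw [Finset.sum_congr rfl (g := fun i => w i * (fun _ => (1:ℝ)) i)]
    · simp; ring
    · intro i hi
      rw [Function.update_of_ne (Finset.ne_of_mem_erase hi)]
  rw [e] at k2
  simp only at k1 k2
  linarith

lemma scalar_le {θ n p s : ℝ} (hp : 0 ≤ p) (hpn : p ≤ n) (hs : 0 ≤ s)
    (h : θ^2 + n = 3 * s^2) : θ * p ≤ 2 * s^3 := by
  rcases le_or_gt θ 0 with h0 | h0
  · have := mul_nonneg (neg_nonneg.2 h0) hp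
    have : 0 ≤ s^3 := by positivity
    nlinarith
  · have h1 : θ * p ≤ θ * n := mul_le_mul_of_nonneg_left hpn h0.le
    have h2 : 0 ≤ (θ - s)^2 * (θ + 2 * s) := by positivity
    have h3 : n = 3 * s^2 - θ^2 := by linarith
    subst h3
    nlinarith

lemma scalar_eq {θ n p s : ℝ} (hp : 0 ≤ p) (hpn : p ≤ n) (hs : 0 < s)
    (h : θ^2 + n = 3 * s^2) (he : θ * p = 2 * s^3) : θ = s ∧ n = 2 * s^2 := by
  have hpos : 0 < θ * p := by rw [he]; positivity
  have h0 : 0 < θ := by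
    by_contra hc
    have := mul_nonneg (neg_nonneg.2 (not_lt.1 hc)) hp
    linarith
  have h1 : θ * p ≤ θ * n := mul_le_mul_of_nonneg_left hpn h0.le
  have h3 : n = 3 * s^2 - θ^2 := by linarith
  subst h3
  have h2 : (θ - s)^2 * (θ + 2 * s) ≤ 0 := by nlinarith
  have h4 : (θ - s)^2 ≤ 0 := by
    by_contra hc
    have := mul_pos (not_le.1 hc) (show 0 < θ + 2 * s by positivity)
    linarith
  have h5 : θ - s = 0 := by
    have := le_antisymm h4 (sq_nonneg _)
    exact pow_eq_zero_iff (two_ne_zero) |>.1 this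
  have h6 : θ = s := by linarith
  exact ⟨h6, by rw [h6]; ring⟩

lemma main_form (d k m : ℕ) (h2 : 2 ≤ k) (hkd : k ≤ d)
    (hm : 1 ≤ m) (lam : ℝ) (hlam : 0 < lam)
    (θs : Fin m → ℝ) (φ : Matrix (Fin d) (Fin m) ℝ)
    (hmin : ∀ s : ℝ,
        popLoss (sourceMeasure d k) θs φ + lam * (normSq θs + frobSq φ)
          ≤ 2/3 * (2 * s^3 - 1)^2 + lam * (3 * s^2)) :
    (θs = 0 ∧ φ = 0) ∨ sourceMinimizerFormII k θs φ := by
  set n : Fin m → ℝ := fun i => ∑ j, φ j i ^ 2 with hn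
  set s : Fin m → ℝ := fun i => Real.sqrt ((θs i ^ 2 + n i) / 3) with hs
  set p : Fin m → ℝ := fun i => ∫ x, (∑ j, φ j i * x j) ^ 2 ∂(srcBranch1 d k) with hp
  have hn0 : ∀ i, 0 ≤ n i := fun i => Finset.sum_nonneg (fun j _ => sq_nonneg _)
  have hp0 : ∀ i, 0 ≤ p i := fun i => integral_nonneg (fun x => sq_nonneg _)
  have hpn : ∀ i, p i ≤ n i := fun i => neuron_mean_le k (fun j => φ j i)
  have hs0 : ∀ i, 0 ≤ s i := fun i => Real.sqrt_nonneg _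
  have hs2 : ∀ i, θs i ^ 2 + n i = 3 * s i ^ 2 := fun i => by
    simp only [hs]
    rw [Real.sq_sqrt (by have := hn0 i; positivity)]; ring
  have hreg : normSq θs + frobSq φ = 3 * ∑ i, s i ^ 2 := by
    unfold normSq frobSq
    rw [Finset.sum_comm, ← Finset.sum_add_distrib, Finset.mul_sum]
    exact Finset.sum_congr rfl (fun i _ => hs2 i)
  set S := Real.sqrt (∑ i, s i ^ 2) with hS
  have hS0 : 0 ≤ S := Real.sqrt_nonneg _
  have hS2 : S ^ 2 = ∑ i, s i ^ 2 := Real.sq_sqrt (Finset.sum_nonneg (fun i _ => sq_nonneg _))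
  have hsS : ∀ i, s i ≤ S := fun i =>
    Real.le_sqrt_of_sq_le
      (Finset.single_le_sum (f := fun i => s i ^ 2) (fun i _ => sq_nonneg _) (Finset.mem_univ i))
  set t := qmean k θs φ with ht
  have htp : t = ∑ i, θs i * p i := qmean_eq k θs φ
  have hterm : ∀ i, θs i * p i ≤ 2 * s i ^ 3 := fun i =>
    scalar_le (hp0 i) (hpn i) (hs0 i) (hs2 i)
  have hterm2 : ∀ i, 2 * s i ^ 3 ≤ 2 * S * s i ^ 2 := fun i => by
    nlinarith [mul_nonneg (sq_nonneg (s i)) (sub_nonneg.2 (hsS i))]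
  have hsum2 : ∑ i, 2 * S * s i ^ 2 = 2 * S ^ 3 := by
    rw [← Finset.mul_sum, ← hS2]; ring
  rw [hreg, ← hS2, popLoss_decomp, ← ht] at hmin
  set I0 := ∫ x, (qnet θs φ x)^2 ∂(srcBranch0 d k) with hI0
  set I1 := ∫ x, (qnet θs φ x - t)^2 ∂(srcBranch1 d k) with hI1
  have hI0n : 0 ≤ I0 := integral_nonneg (fun x => sq_nonneg _)
  have hI1n : 0 ≤ I1 := integral_nonneg (fun x => sq_nonneg _)
  have hzero : ∀ i, s i = 0 → θs i = 0 ∧ ∀ l, φ l i = 0 := by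
    intro i hi
    have h := hs2 i
    rw [hi] at h
    have hni := hn0 i
    have hn' : n i = 0 := by nlinarith [sq_nonneg (θs i)]
    refine ⟨by rw [hn'] at h; simpa using h, fun l => ?_⟩
    have := (Finset.sum_eq_zero_iff_of_nonneg (fun j _ => sq_nonneg (φ j i))).1 hn' l
      (Finset.mem_univ l)
    simpa using this
  rcases le_or_gt t 0 with ht0 | ht0
  · left
    have h := hmin 0
    have hS' : S ^ 2 = 0 := by
      have : lam * S ^ 2 ≤ 0 := by nlinarith
      have h3 := sq_nonneg S
      by_contra hc
      have := mul_pos hlam (lt_of_le_of_ne h3 (Ne.symm hc))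
      linarith
    have hSz : S = 0 := by simpa using hS'
    have hsz : ∀ i, s i = 0 := fun i => le_antisymm (hSz ▸ hsS i) (hs0 i)
    exact ⟨funext fun i => (hzero i (hsz i)).1, by ext l i; exact (hzero i (hsz i)).2 l⟩
  · right
    obtain ⟨r, hr0, hr⟩ : ∃ r : ℝ, 0 < r ∧ 2 * r ^ 3 = t := by
      refine ⟨(t/2) ^ ((1:ℝ)/3), by positivity, ?_⟩
      rw [← Real.rpow_natCast, ← Real.rpow_mul (by positivity)]
      norm_num
      ring
    have hmr := hmin r
    rw [hr] at hmr
    have htS : t ≤ 2 * S ^ 3 := by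
      rw [htp, ← hsum2]
      exact Finset.sum_le_sum (fun i _ => (hterm i).trans (hterm2 i))
    have hrS : r ≤ S := by
      have : r ^ 3 ≤ S ^ 3 := by linarith
      exact le_of_pow_le_pow_left₀ (by norm_num) hS0 this
    have hrS2 : lam * r ^ 2 ≤ lam * S ^ 2 := by gcongr
    have hI0z : I0 = 0 := by linarith
    have hI1z : I1 = 0 := by linarith
    have hSr2 : S ^ 2 ≤ r ^ 2 := by
      have : lam * S ^ 2 ≤ lam * r ^ 2 := by linarith
      exact le_of_mul_le_mul_left this hlam
    have hSr : S = r := le_antisymm (le_of_pow_le_pow_left₀ (by norm_num) hr0.le hSr2) hrS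
    have hSpos : 0 < S := hSr ▸ hr0
    have htS' : t = 2 * S ^ 3 := by rw [← hr, hSr]
    have heq : ∀ i, θs i * p i = 2 * S * s i ^ 2 := by
      have := (Finset.sum_eq_sum_iff_of_le
        (fun i (_ : i ∈ Finset.univ) => (hterm i).trans (hterm2 i))).1
        (by rw [← htp, hsum2, htS'])
      exact fun i => this i (Finset.mem_univ i)
    have hsi : ∀ i, s i = 0 ∨ s i = S := by
      intro i
      have h1 := heq i
      have h2 := hterm i
      have h3 := hterm2 i
      have h4 : s i ^ 2 * (S - s i) = 0 := by nlinarith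
      rcases mul_eq_zero.1 h4 with h | h
      · left; simpa using h
      · right; linarith
    obtain ⟨i0, hi0⟩ : ∃ i, s i = S := by
      by_contra hc
      push Not at hc
      have : ∀ i, s i = 0 := fun i => (hsi i).resolve_right (hc i)
      rw [show (∑ i, s i ^ 2) = 0 by simp [this]] at hS2
      nlinarith
    have hoth : ∀ i, i ≠ i0 → s i = 0 := by
      intro i hi
      rcases hsi i with h | h
      · exact h
      · exfalso
        have := Finset.sum_le_sum_of_subset_of_nonneg (f := fun i => s i ^ 2)
          (Finset.subset_univ ({i, i0} : Finset (Fin m))) (fun i _ _ => sq_nonneg _)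
        rw [Finset.sum_pair hi, ← hS2, h, hi0] at this
        nlinarith
    have hse := scalar_eq (hp0 i0) (hpn i0) (by rw [hi0]; exact hSpos) (hs2 i0)
      (by rw [heq i0, hi0]; ring)
    have hθS : θs i0 = S := hse.1.trans hi0
    have hnS : n i0 = 2 * S ^ 2 := by rw [hse.2, hi0]
    have hq : ∀ x, qnet θs φ x = S * (∑ j, φ j i0 * x j) ^ 2 := by
      intro x
      unfold qnet
      rw [Finset.sum_eq_single i0, hθS]
      · intro b _ hb
        rw [(hzero b (hoth b hb)).1, zero_mul]
      · simp
    have hqc := qnet_cont θs φ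
    obtain ⟨j, hjk, hj⟩ := rigid k (fun j => φ j i0) (2 * S ^ 2) (by positivity)
      (by
        intro x hx
        have := atom_zero (nu0 d k) (qnet θs φ) (int0 _ (by fun_prop)) hI0z x hx
        rw [hq] at this
        exact (mul_eq_zero.1 this).resolve_left hSpos.ne')
      (by
        intro x hx
        have := atom_zero (nu1 d k) (fun x => qnet θs φ x - t) (int1 _ (by fun_prop)) hI1z x hx
        simp only [hq, htS'] at this
        have h5 : S * ((∑ j, φ j i0 * x j) ^ 2 - 2 * S ^ 2) = 0 := by linarith
        have := (mul_eq_zero.1 h5).resolve_left hSpos.ne'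
        linarith)
    have hnj : n i0 = φ j i0 ^ 2 := by
      simp only [hn]
      rw [Finset.sum_eq_single j]
      · intro b _ hb
        rw [hj b hb]; ring
      · simp
    have hsq : φ j i0 ^ 2 = (Real.sqrt 2 * S) ^ 2 := by
      rw [← hnj, hnS, mul_pow, Real.sq_sqrt (show (0:ℝ) ≤ 2 by norm_num)]
    refine ⟨i0, j, hjk, by rw [hθS]; exact hSpos, ?_, fun i hi => hzero i (hoth i hi)⟩
    rw [hθS]
    rcases sq_eq_sq_iff_eq_or_eq_neg.1 hsq with h | h
    · left
      intro l
      split_ifs with hl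
      · rw [hl, h, mul_one]
      · rw [mul_zero]; exact hj l hl
    · right
      intro l
      split_ifs with hl
      · rw [hl, h, mul_one]
      · rw [mul_zero]; exact hj l hl

/-- Lemma 4: every global minimizer of the regularized source objective
`L_source^λ(θ_s, φ) = L_{D_s^{(k)}}(θ_s, φ) + λ(‖θ_s‖² + ‖φ‖_F²)` is either identically
zero (form (i)) or of form (ii); moreover for `0 < λ < 0.1` only form (ii) occurs. -/
theorem source_minimizer_characterization (d k m : ℕ) (h2 : 2 ≤ k) (hkd : k ≤ d)
    (hm : 1 ≤ m) (lam : ℝ) (hlam : 0 < lam)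
    (θs : Fin m → ℝ) (φ : Matrix (Fin d) (Fin m) ℝ)
    (hmin : ∀ (θ' : Fin m → ℝ) (φ' : Matrix (Fin d) (Fin m) ℝ),
        popLoss (sourceMeasure d k) θs φ + lam * (normSq θs + frobSq φ)
          ≤ popLoss (sourceMeasure d k) θ' φ' + lam * (normSq θ' + frobSq φ')) :
    ((θs = 0 ∧ φ = 0) ∨ sourceMinimizerFormII k θs φ)
      ∧ (lam < 0.1 → sourceMinimizerFormII k θs φ) := by
  have hmin' : ∀ s : ℝ, popLoss (sourceMeasure d k) θs φ + lam * (normSq θs + frobSq φ)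
      ≤ 2/3 * (2 * s^3 - 1)^2 + lam * (3 * s^2) := by
    intro s
    have h := hmin (fun i => if i = ⟨0, by omega⟩ then s else 0)
      (compPhi ⟨0, by omega⟩ ⟨0, by omega⟩ s)
    rw [comp_reg, comp_loss k _ _ (by simp; omega)] at h
    exact h
  have hmain := main_form d k m h2 hkd hm lam hlam θs φ hmin'
  refine ⟨hmain, fun hl => hmain.resolve_left ?_⟩
  rintro ⟨h1, h2'⟩
  have h := hmin' (1/2)
  have hz : popLoss (sourceMeasure d k) θs φ = 2/3 := by
    rw [popLoss_eq, h1, h2']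
    simp [qnet]
  have hr : normSq θs + frobSq φ = 0 := by
    rw [h1, h2']; simp [normSq, frobSq]
  rw [hz, hr] at h
  norm_num at h hl
  linarith
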